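/- arXiv:1612.07354 — 3 statements merged into one kernel-verified Lean document; each statement's English description precedes it below -/
import Mathlib

section
/- Every Čech-complete topological space with the Menger property is σ-compact. -/
/-- A topological space has the Menger property if for every sequence of open
covers there are finite subfamilies whose union covers the space. -/
def MengerSpace (X : Type*) [TopologicalSpace X] : Prop :=
  ∀ 𝒰 : ℕ → Set (Set X),
    (∀ n, (∀ s ∈ 𝒰 n, IsOpen s) ∧ ⋃₀ 𝒰 n = Set.univ) →
    ∃ ℱ : ℕ → Set (Set X),
      (∀ n, ℱ n ⊆ 𝒰 n ∧ (ℱ n).Finite) ∧ ⋃ n, ⋃₀ ℱ n = Set.univ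

/-- A Tychonoff space is Čech-complete if its image in its Stone–Čech
compactification is a Gδ set. -/
def CechComplete (X : Type*) [TopologicalSpace X] : Prop :=
  IsGδ (Set.range (stoneCechUnit : X → StoneCech X))

open Set Filter Topology Metric

lemma MengerSpace.of_surjective {X Y : Type*} [TopologicalSpace X] [TopologicalSpace Y]
    (h : MengerSpace X) (f : X → Y) (hf : Continuous f) (hs : Function.Surjective f) :
    MengerSpace Y := by
  intro U hU
  obtain ⟨F, hF, hcov⟩ := h (fun n => (fun s => f ⁻¹' s) '' U n) (by
    intro n
    refine ⟨?_, ?_⟩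
    · rintro _ ⟨s, hs, rfl⟩
      exact ((hU n).1 s hs).preimage hf
    · rw [eq_univ_iff_forall]
      intro x
      have : f x ∈ ⋃₀ U n := by rw [(hU n).2]; trivial
      obtain ⟨s, hs, hx⟩ := this
      exact ⟨_, ⟨s, hs, rfl⟩, hx⟩)
  have hinj : Function.Injective (fun s : Set Y => f ⁻¹' s) := hs.preimage_injective
  refine ⟨fun n => (fun s => f ⁻¹' s) ⁻¹' F n, fun n => ⟨?_, ?_⟩, ?_⟩
  · intro s hs
    obtain ⟨t, ht, hts⟩ := (hF n).1 hs
    rwa [← hinj hts]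
  · exact (hF n).2.preimage hinj.injOn
  · rw [eq_univ_iff_forall]
    intro y
    obtain ⟨x, rfl⟩ := hs y
    have : x ∈ ⋃ n, ⋃₀ F n := by rw [hcov]; trivial
    obtain ⟨n, V, hV, hx⟩ := mem_iUnion.1 this
    obtain ⟨t, ht, rfl⟩ := (hF n).1 hV
    exact mem_iUnion.2 ⟨n, t, hV, hx⟩

lemma MengerSpace.countable_cover {X : Type*} [TopologicalSpace X] [Nonempty X]
    (h : MengerSpace X) (U : X → Set X) (hU : ∀ x, IsOpen (U x)) (hx : ∀ x, x ∈ U x) :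
    ∃ c : ℕ → X, ∀ x, ∃ k, x ∈ U (c k) := by
  obtain ⟨F, hF, hcov⟩ := h (fun _ => range U) (by
    intro n
    refine ⟨?_, ?_⟩
    · rintro _ ⟨x, rfl⟩; exact hU x
    · rw [eq_univ_iff_forall]
      exact fun x => ⟨_, ⟨x, rfl⟩, hx x⟩)
  have hc : (⋃ n, F n).Countable := countable_iUnion fun n => (hF n).2.countable
  have hne : (⋃ n, F n).Nonempty := by
    obtain ⟨x⟩ := ‹Nonempty X›
    have : x ∈ ⋃ n, ⋃₀ F n := by rw [hcov]; trivial
    obtain ⟨n, V, hV, -⟩ := mem_iUnion.1 this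
    exact ⟨V, mem_iUnion.2 ⟨n, hV⟩⟩
  obtain ⟨e, he⟩ := hc.exists_eq_range hne
  have : ∀ k, ∃ x, U x = e k := by
    intro k
    have : e k ∈ ⋃ n, F n := by rw [he]; exact ⟨k, rfl⟩
    obtain ⟨n, hn⟩ := mem_iUnion.1 this
    exact (hF n).1 hn
  choose c hc using this
  refine ⟨c, fun x => ?_⟩
  have : x ∈ ⋃ n, ⋃₀ F n := by rw [hcov]; trivial
  obtain ⟨n, V, hV, hxV⟩ := mem_iUnion.1 this
  have : V ∈ range e := by rw [← he]; exact mem_iUnion.2 ⟨n, hV⟩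
  obtain ⟨k, rfl⟩ := this
  exact ⟨k, by rwa [hc]⟩

lemma isGδ_polish {M : Type*} [TopologicalSpace M] [PolishSpace M] {s : Set M} (hs : IsGδ s) :
    PolishSpace s := by
  obtain ⟨O, hO, rfl⟩ := isGδ_iff_eq_iInter_nat.1 hs
  have : ∀ n, PolishSpace (O n) := fun n => (hO n).polishSpace
  let f : (⋂ n, O n : Set M) → ∀ n, O n := fun x n => ⟨x.1, mem_iInter.1 x.2 n⟩
  have hf : Continuous f := by fun_prop
  refine IsClosedEmbedding.polishSpace (f := f) ⟨⟨?_, ?_⟩, ?_⟩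
  · refine IsInducing.of_comp hf (g := fun y : ∀ n, O n => (y 0 : M)) (by fun_prop) ?_
    exact IsInducing.subtypeVal
  · intro x y hxy
    have := congrArg (fun z : ∀ n, O n => (z 0 : M)) hxy
    exact Subtype.ext this
  · have : range f = ⋂ n, {y : ∀ n, O n | (y n : M) = y 0} := by
      ext y
      simp only [mem_range, mem_iInter, mem_ofPred_eq]
      constructor
      · rintro ⟨x, rfl⟩ n; rfl
      · intro h
        refine ⟨⟨y 0, mem_iInter.2 fun n => by rw [← h n]; exact (y n).2⟩, ?_⟩
        funext n
        exact Subtype.ext (h n).symm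
    rw [this]
    exact isClosed_iInter fun n => isClosed_eq (by fun_prop) (by fun_prop)

lemma separated_step {Z : Type*} [MetricSpace Z] [CompleteSpace Z] {P : Set Z} (hP : IsClosed P)
    (x : Z) (r : ℝ) (hr : 0 < r) (hnc : ¬ IsCompact (closedBall x (r / 2) ∩ P)) :
    ∃ (y : ℕ → Z) (δ : ℝ), 0 < δ ∧ δ ≤ r / 2 ∧ (∀ k, y k ∈ P) ∧
      (∀ k, closedBall (y k) δ ⊆ closedBall x r) ∧
      LocallyFinite fun k => closedBall (y k) δ := by
  have hcl : IsClosed (closedBall x (r / 2) ∩ P) := isClosed_closedBall.inter hP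
  have htb : ¬ TotallyBounded (closedBall x (r / 2) ∩ P) := fun h =>
    hnc (h.isCompact_of_isClosed hcl)
  rw [Metric.totallyBounded_iff] at htb
  push Not at htb
  obtain ⟨ε, hε, h⟩ := htb
  obtain ⟨y, hy, hsep⟩ := exists_seq_of_forall_finset_exists
    (fun z => z ∈ closedBall x (r / 2) ∩ P) (fun a b => ε ≤ dist a b) (by
      intro s _
      obtain ⟨b, hb, hb'⟩ := not_subset.1 (h s s.finite_toSet)
      refine ⟨b, hb, fun a ha => ?_⟩
      by_contra hlt
      push Not at hlt
      exact hb' (mem_iUnion₂.2 ⟨a, ha, by rwa [mem_ball, dist_comm]⟩))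
  refine ⟨y, min (r / 2) (ε / 4), by positivity, min_le_left _ _, fun k => (hy k).2, ?_, ?_⟩
  · intro k
    apply closedBall_subset_closedBall'
    have := mem_closedBall.1 (hy k).1
    have := min_le_left (r / 2) (ε / 4)
    linarith
  · intro z
    refine ⟨ball z (ε / 8), ball_mem_nhds _ (by positivity), ?_⟩
    apply Set.Subsingleton.finite
    have key : ∀ i j, i < j → (closedBall (y i) (min (r / 2) (ε / 4)) ∩ ball z (ε / 8)).Nonempty →
        (closedBall (y j) (min (r / 2) (ε / 4)) ∩ ball z (ε / 8)).Nonempty → False := by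
      rintro i j hij ⟨a, ha, ha'⟩ ⟨b, hb, hb'⟩
      have h1 := hsep i j hij
      have h2 := min_le_right (r / 2) (ε / 4)
      rw [mem_closedBall] at ha hb
      rw [mem_ball] at ha' hb'
      have h3 := dist_triangle (y i) a z
      have h4 := dist_triangle (y i) z (y j)
      have h5 := dist_triangle z b (y j)
      rw [dist_comm (y i) a] at h3
      rw [dist_comm z b] at h5
      linarith
    intro i hi j hj
    rcases lt_trichotomy i j with h | h | h
    · exact (key i j h hi hj).elim
    · exact h
    · exact (key j i h hj hi).elim

/-- A complete metric space with a nonempty nowhere locally compact closed subset is not Menger. -/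
lemma not_menger_of_tree {Z : Type*} [MetricSpace Z] [CompleteSpace Z] (hM : MengerSpace Z)
    {P : Set Z} (hP : IsClosed P) (hne : P.Nonempty)
    (hnc : ∀ x ∈ P, ∀ r > 0, ¬ IsCompact (closedBall x r ∩ P)) : False := by
  let N := {p : Z × ℝ // p.1 ∈ P ∧ 0 < p.2}
  have step : ∀ p : N, ∃ q : ℕ → N, (∀ k, (q k).1.2 ≤ p.1.2 / 2) ∧
      (∀ k, closedBall (q k).1.1 (q k).1.2 ⊆ closedBall p.1.1 p.1.2) ∧
      LocallyFinite fun k => closedBall (q k).1.1 (q k).1.2 := by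
    rintro ⟨⟨x, r⟩, hx, hr⟩
    obtain ⟨y, δ, h1, h2, h3, h4, h5⟩ :=
      separated_step hP x r hr (hnc x hx (r / 2) (half_pos hr))
    exact ⟨fun k => ⟨⟨y k, δ⟩, h3 k, h1⟩, fun _ => h2, h4, h5⟩
  choose next hrad hsub hlf using step
  obtain ⟨x₀, hx₀⟩ := hne
  let root : N := ⟨⟨x₀, 1⟩, hx₀, one_pos⟩
  let node : List ℕ → N := fun s => s.foldr (fun k p => next p k) root
  have node_cons : ∀ k s, node (k :: s) = next (node s) k := fun _ _ => rfl
  let A : List ℕ → Set Z := fun s => closedBall (node s).1.1 (node s).1.2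
  have hlev : ∀ n, LocallyFinite fun s : List ℕ => {z | z ∈ A s ∧ s.length = n} := by
    intro n
    induction n with
    | zero =>
      intro z
      refine ⟨univ, univ_mem, (finite_singleton ([] : List ℕ)).subset ?_⟩
      rintro s ⟨w, ⟨-, hw⟩, -⟩
      exact List.length_eq_zero_iff.1 hw
    | succ n ih =>
      intro z
      obtain ⟨U, hU, hfin⟩ := ih z
      choose V hV hVfin using fun s => hlf (node s) z
      refine ⟨U ∩ ⋂ s ∈ {s : List ℕ | ({z | z ∈ A s ∧ s.length = n} ∩ U).Nonempty}, V s,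
        inter_mem hU ((biInter_mem hfin).2 fun s _ => hV s), ?_⟩
      refine (hfin.biUnion (t := fun s => (fun k => k :: s) '' _)
        fun s _ => (hVfin s).image _).subset ?_
      rintro s ⟨w, ⟨hw, hlen⟩, hwU, hwV⟩
      cases s with
      | nil => simp at hlen
      | cons k s =>
        have hlen' : s.length = n := by simpa using hlen
        have hs : s ∈ {s : List ℕ | ({z | z ∈ A s ∧ s.length = n} ∩ U).Nonempty} :=
          ⟨w, ⟨hsub (node s) k hw, hlen'⟩, hwU⟩
        exact mem_biUnion hs ⟨k, ⟨w, hw, mem_iInter₂.1 hwV s hs⟩, rfl⟩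
  let D : ℕ → ℕ → List ℕ → Set Z := fun n k s => {z | z ∈ A s ∧ s.length = n + 1 ∧ k ≤ s.headI}
  let W : ℕ → ℕ → Set Z := fun n k => (⋃ s, D n k s)ᶜ
  have hWo : ∀ n k, IsOpen (W n k) := by
    intro n k
    apply IsClosed.isOpen_compl (self := ?_)
    refine LocallyFinite.isClosed_iUnion ((hlev (n + 1)).subset fun s z hz => ⟨hz.1, hz.2.1⟩) ?_
    intro s
    by_cases h : s.length = n + 1 ∧ k ≤ s.headI
    · have : D n k s = A s := by ext z; simp [D, h]
      rw [this]; exact isClosed_closedBall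
    · have : D n k s = ∅ := by
        ext z
        simp only [D, mem_ofPred_eq, mem_empty_iff_false, iff_false]
        exact fun hz => h hz.2
      rw [this]; exact isClosed_empty
  have hWm : ∀ n j k, j ≤ k → W n j ⊆ W n k := by
    intro n j k hjk
    apply compl_subset_compl.2
    exact iUnion_mono fun s z hz => ⟨hz.1, hz.2.1, hjk.trans hz.2.2⟩
  have hWc : ∀ n z, ∃ k, z ∈ W n k := by
    intro n z
    have hfin := (hlev (n + 1)).point_finite z
    obtain ⟨b, hb⟩ := (hfin.image List.headI).bddAbove
    refine ⟨b + 1, ?_⟩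
    intro hz
    obtain ⟨s, hs1, hs2, hs3⟩ := mem_iUnion.1 hz
    have := hb ⟨s, ⟨hs1, hs2⟩, rfl⟩
    omega
  obtain ⟨F, hF, hcov⟩ := hM (fun n => range (W n)) (by
    intro n
    refine ⟨?_, ?_⟩
    · rintro _ ⟨k, rfl⟩; exact hWo n k
    · rw [eq_univ_iff_forall]
      intro z
      obtain ⟨k, hk⟩ := hWc n z
      exact ⟨_, ⟨k, rfl⟩, hk⟩)
  have hb : ∀ n, ∃ k, ⋃₀ F n ⊆ W n k := by
    intro n
    have : ∀ V : Set Z, ∃ k, V ∈ F n → V = W n k := by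
      intro V
      by_cases hV : V ∈ F n
      · obtain ⟨k, hk⟩ := (hF n).1 hV
        exact ⟨k, fun _ => hk.symm⟩
      · exact ⟨0, fun h => (hV h).elim⟩
    choose κ hκ using this
    obtain ⟨b, hb⟩ := ((hF n).2.image κ).bddAbove
    refine ⟨b, sUnion_subset fun V hV => ?_⟩
    rw [hκ V hV]
    exact hWm n _ _ (hb ⟨V, hV, rfl⟩)
  choose f hf using hb
  let t : ℕ → List ℕ := fun n => Nat.rec [] (fun n s => f n :: s) n
  have ht : ∀ n, t (n + 1) = f n :: t n := fun _ => rfl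
  have hlen : ∀ n, (t n).length = n := by
    intro n
    induction n with
    | zero => rfl
    | succ n ih => rw [ht, List.length_cons, ih]
  have hanti : Antitone fun n => A (t n) :=
    antitone_nat_of_succ_le fun n => hsub (node (t n)) (f n)
  have hr : ∀ n, (node (t n)).1.2 ≤ (1 / 2) ^ n := by
    intro n
    induction n with
    | zero => simp [t, node, root]
    | succ n ih =>
      have := hrad (node (t n)) (f n)
      rw [ht, node_cons, pow_succ]
      linarith
  have hdiam : Tendsto (fun n => diam (A (t n))) atTop (𝓝 0) := by
    have h0 : Tendsto (fun n : ℕ => 2 * (1 / 2 : ℝ) ^ n) atTop (𝓝 0) := by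
      have := (tendsto_pow_atTop_nhds_zero_of_lt_one (r := (1 / 2 : ℝ))
        (by norm_num) (by norm_num)).const_mul 2
      simpa using this
    refine squeeze_zero (fun _ => diam_nonneg) (fun n => ?_) h0
    refine (diam_closedBall (node (t n)).2.2.le).trans ?_
    have := hr n
    linarith
  obtain ⟨z, hz⟩ := nonempty_iInter_of_nonempty_biInter (s := fun n => A (t n))
    (fun n => isClosed_closedBall) (fun n => isBounded_closedBall)
    (fun K => ⟨(node (t K)).1.1, mem_iInter₂.2 fun n hn =>
      hanti hn (mem_closedBall_self (node (t K)).2.2.le)⟩) hdiam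
  have hz' : z ∈ ⋃ n, ⋃₀ F n := by rw [hcov]; trivial
  obtain ⟨n, hn⟩ := mem_iUnion.1 hz'
  refine hf n hn (mem_iUnion.2 ⟨t (n + 1), mem_iInter.1 hz (n + 1), hlen (n + 1), ?_⟩)
  rw [ht]
  exact le_rfl

/-- Hurewicz: Menger Polish spaces are σ-compact. -/
lemma menger_polish {Z : Type*} [TopologicalSpace Z] [PolishSpace Z] (hM : MengerSpace Z) :
    IsSigmaCompact (univ : Set Z) := by
  let _ := TopologicalSpace.upgradeIsCompletelyMetrizable Z
  let Q : Set Z := {z | ∃ S, IsSigmaCompact S ∧ S ∈ 𝓝 z}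
  have hQo : IsOpen Q := by
    rw [isOpen_iff_mem_nhds]
    rintro z ⟨S, hS, hz⟩
    filter_upwards [eventually_mem_nhds_iff.2 hz] with w hw
    exact ⟨S, hS, hw⟩
  have hQ : ∃ T, IsSigmaCompact T ∧ Q ⊆ T := by
    have : ∀ z, ∃ S : Set Z, IsSigmaCompact S ∧ (z ∈ Q → S ∈ 𝓝 z) := by
      intro z
      by_cases hz : z ∈ Q
      · obtain ⟨S, h1, h2⟩ := hz
        exact ⟨S, h1, fun _ => h2⟩
      · exact ⟨∅, isSigmaCompact_empty, fun h => (hz h).elim⟩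
    choose S hS hSn using this
    obtain ⟨c, -, hc, hcov⟩ := TopologicalSpace.countable_cover_nhdsWithin (f := S) (s := Q)
      fun z hz => mem_nhdsWithin_of_mem_nhds (hSn z hz)
    exact ⟨_, isSigmaCompact_biUnion hc fun i _ => hS i, hcov⟩
  obtain ⟨T, hT, hQT⟩ := hQ
  by_cases hne : (Qᶜ).Nonempty
  · refine (not_menger_of_tree hM hQo.isClosed_compl hne ?_).elim
    intro x hx r hr hcomp
    refine hx ⟨(closedBall x r ∩ Qᶜ) ∪ T, ?_, ?_⟩
    · rw [union_eq_iUnion]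
      refine isSigmaCompact_iUnion _ ?_
      rintro (_ | _)
      · exact hT
      · exact hcomp.isSigmaCompact
    · filter_upwards [closedBall_mem_nhds x hr] with w hw
      by_cases hwQ : w ∈ Q
      · exact Or.inr (hQT hwQ)
      · exact Or.inl ⟨hw, hwQ⟩
  · rw [not_nonempty_iff_eq_empty, compl_empty_iff] at hne
    rw [hne] at hQT
    rwa [← univ_subset_iff.1 hQT]

/-- Every Čech-complete (Tychonoff) topological space with the Menger property is
σ-compact. -/
theorem menger_cechComplete_sigmaCompact (X : Type*) [TopologicalSpace X] [T35Space X]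
    (hCech : CechComplete X) (hMenger : MengerSpace X) :
    SigmaCompactSpace X := by
  rcases isEmpty_or_nonempty X with hX | hX
  · infer_instance
  obtain ⟨G, hGo, hG⟩ := isGδ_iff_eq_iInter_nat.1 hCech
  have hmem : ∀ x n, stoneCechUnit x ∈ G n := fun x n =>
    mem_iInter.1 (hG ▸ mem_range_self x : stoneCechUnit x ∈ ⋂ n, G n) n
  have hfun : ∀ n (x : X), ∃ φ : C(StoneCech X, ℝ),
      0 < φ (stoneCechUnit x) ∧ ∀ z, 0 < φ z → z ∈ G n := by
    intro n x
    obtain ⟨φ, h0, h1, -⟩ := exists_continuous_zero_one_of_isClosed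
      (s := (G n)ᶜ) (t := {stoneCechUnit x}) (hGo n).isClosed_compl isClosed_singleton
      (by simpa using hmem x n)
    refine ⟨φ, ?_, fun z hz => ?_⟩
    · rw [h1 rfl]; exact one_pos
    · by_contra hn
      have := h0 hn
      simp only [Pi.zero_apply] at this
      linarith
  choose φ hφ hφG using hfun
  have hcov : ∀ n, ∃ c : ℕ → X, ∀ x, ∃ k, 0 < φ n (c k) (stoneCechUnit x) := fun n =>
    hMenger.countable_cover (fun c => {x | 0 < φ n c (stoneCechUnit x)})
      (fun c => isOpen_lt continuous_const ((φ n c).continuous.comp continuous_stoneCechUnit))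
      (fun x => hφ n x)
  choose c hc using hcov
  let g : StoneCech X → (ℕ × ℕ → ℝ) := fun z p => φ p.1 (c p.1 p.2) z
  have hg : Continuous g := continuous_pi fun p => (φ p.1 (c p.1 p.2)).continuous
  let Y : Set (ℕ × ℕ → ℝ) := ⋂ n, ⋃ k, {y | 0 < y (n, k)}
  have hY : IsGδ Y := IsGδ.iInter_of_isOpen fun n => isOpen_iUnion fun k =>
    isOpen_lt continuous_const (continuous_apply _)
  have hpre : ∀ z, g z ∈ Y → z ∈ range (stoneCechUnit : X → StoneCech X) := by
    intro z hz
    rw [hG]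
    refine mem_iInter.2 fun n => ?_
    obtain ⟨k, hk⟩ := mem_iUnion.1 (mem_iInter.1 hz n)
    exact hφG n _ z hk
  have hXY : ∀ x, g (stoneCechUnit x) ∈ Y := fun x => mem_iInter.2 fun n =>
    mem_iUnion.2 (hc n x)
  let Z : Set (ℕ × ℕ → ℝ) := range g ∩ Y
  have hZ : IsGδ Z := (isCompact_range hg).isClosed.isGδ.inter hY
  have : PolishSpace Z := isGδ_polish hZ
  have hMZ : MengerSpace Z := hMenger.of_surjective
    (fun x => ⟨g (stoneCechUnit x), mem_range_self _, hXY x⟩)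
    ((hg.comp continuous_stoneCechUnit).subtype_mk _) (by
      rintro ⟨_, ⟨z, rfl⟩, hz⟩
      obtain ⟨x, rfl⟩ := hpre z hz
      exact ⟨x, rfl⟩)
  obtain ⟨C, hC, hCu⟩ := isSigmaCompact_iff_isSigmaCompact_univ.2 (menger_polish hMZ)
  refine ⟨⟨fun i => (fun x => g (stoneCechUnit x)) ⁻¹' C i, fun i => ?_, ?_⟩⟩
  · rw [isInducing_stoneCechUnit.isCompact_iff]
    have : stoneCechUnit '' ((fun x : X => g (stoneCechUnit x)) ⁻¹' C i) = g ⁻¹' C i := by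
      ext z
      constructor
      · rintro ⟨x, hx, rfl⟩; exact hx
      · intro hz
        have hzZ : g z ∈ Z := hCu ▸ mem_iUnion.2 ⟨i, hz⟩
        obtain ⟨x, rfl⟩ := hpre z hzZ.2
        exact ⟨x, hz, rfl⟩
    rw [this]
    exact ((hC i).isClosed.preimage hg).isCompact
  · rw [← preimage_iUnion, hCu, eq_univ_iff_forall]
    exact fun x => ⟨mem_range_self _, hXY x⟩
end

section
/- Every weakly linearly Lindelöf monotonically normal topological space is Lindelöf. -/
universe u

open Cardinal

/-- A space is weakly linearly Lindelöf if for every uncountable regular cardinal κ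
and every family of κ-many nonempty open sets, some point has all of its
neighborhoods meeting κ-many members of the family. -/
def WeaklyLinearlyLindelof (X : Type u) [TopologicalSpace X] : Prop :=
  ∀ κ : Cardinal.{u}, κ.IsRegular → ℵ₀ < κ →
    ∀ 𝒰 : Set (Set X), (∀ U ∈ 𝒰, IsOpen U ∧ U.Nonempty) → #↥𝒰 = κ →
      ∃ x : X, ∀ V ∈ nhds x, #↥{U | U ∈ 𝒰 ∧ (U ∩ V).Nonempty} = κ

/-- A T1 space is monotonically normal if there is an operator `G` assigning to each
point `x` in an open set `U` an open set `G x U` with `x ∈ G x U ⊆ U` such that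
whenever `G x U` meets `G y V` we have `x ∈ V` or `y ∈ U`. -/
def MonotonicallyNormal (X : Type u) [TopologicalSpace X] : Prop :=
  T1Space X ∧ ∃ G : X → Set X → Set X,
    (∀ x U, IsOpen U → x ∈ U → IsOpen (G x U) ∧ x ∈ G x U ∧ G x U ⊆ U) ∧
    (∀ x U y V, IsOpen U → x ∈ U → IsOpen V → y ∈ V →
      (G x U ∩ G y V).Nonempty → x ∈ V ∨ y ∈ U)

section Helpers

open Set

variable {X : Type u} [TopologicalSpace X]

/-- The two laws of a monotone normality operator. -/
def IsMNOp (G : X → Set X → Set X) : Prop :=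
    (∀ x U, IsOpen U → x ∈ U → IsOpen (G x U) ∧ x ∈ G x U ∧ G x U ⊆ U) ∧
    (∀ x U y V, IsOpen U → x ∈ U → IsOpen V → y ∈ V →
      (G x U ∩ G y V).Nonempty → x ∈ V ∨ y ∈ U)

/-- Iterates of the operator applied to the initial segments of a rank function. -/
def Viter {K : Type*} [LinearOrder K] (G : X → Set X → Set X) (ρ : X → K) : ℕ → X → Set X
  | 0, y => {x | ρ x ≤ ρ y}
  | j + 1, y => G y (Viter G ρ j y)

section Iter
variable {K : Type*} [LinearOrder K] {G : X → Set X → Set X} {ρ : X → K}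

lemma viter_basic (hG : IsMNOp G) (hρ : ∀ k, IsOpen {x | ρ x ≤ k}) (j : ℕ) (y : X) :
    IsOpen (Viter G ρ j y) ∧ y ∈ Viter G ρ j y := by
  induction j with
  | zero => exact ⟨hρ _, le_refl (ρ y)⟩
  | succ j ih =>
    have := hG.1 y _ ih.1 ih.2
    exact ⟨this.1, this.2.1⟩

lemma viter_succ_subset (hG : IsMNOp G) (hρ : ∀ k, IsOpen {x | ρ x ≤ k}) (j : ℕ) (y : X) :
    Viter G ρ (j + 1) y ⊆ Viter G ρ j y := by
  have ih := viter_basic hG hρ j y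
  exact (hG.1 y _ ih.1 ih.2).2.2

lemma viter_anti (hG : IsMNOp G) (hρ : ∀ k, IsOpen {x | ρ x ≤ k}) {i j : ℕ} (h : i ≤ j) (y : X) :
    Viter G ρ j y ⊆ Viter G ρ i y := by
  induction h with
  | refl => exact subset_rfl
  | step _ ih => exact (viter_succ_subset hG hρ _ y).trans ih

lemma viter_rank (hG : IsMNOp G) (hρ : ∀ k, IsOpen {x | ρ x ≤ k}) {j : ℕ} {x y : X}
    (h : x ∈ Viter G ρ j y) : ρ x ≤ ρ y :=
  viter_anti hG hρ (Nat.zero_le j) y h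

lemma viter_meet (hG : IsMNOp G) (hρ : ∀ k, IsOpen {x | ρ x ≤ k}) {j : ℕ} {y y' z : X}
    (h : z ∈ Viter G ρ (j + 1) y) (h' : z ∈ Viter G ρ (j + 1) y') :
    y ∈ Viter G ρ j y' ∨ y' ∈ Viter G ρ j y := by
  have b := viter_basic hG hρ j y
  have b' := viter_basic hG hρ j y'
  exact hG.2 y _ y' _ b.1 b.2 b'.1 b'.2 ⟨z, h, h'⟩

lemma viter_meet_lt (hG : IsMNOp G) (hρ : ∀ k, IsOpen {x | ρ x ≤ k}) {j : ℕ} {y y' z : X}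
    (h : z ∈ Viter G ρ (j + 1) y) (h' : z ∈ Viter G ρ (j + 1) y') (hlt : ρ y < ρ y') :
    y ∈ Viter G ρ j y' :=
  (viter_meet hG hρ h h').resolve_right fun h => absurd (viter_rank hG hρ h) (not_le.2 hlt)

end Iter

/-- Monotonically normal spaces: countable increasing open covers shrink to closed covers. -/
lemma mn_shrink [T1Space X] {G : X → Set X → Set X} (hG : IsMNOp G) (ρ : X → ℕ)
    (hρ : ∀ k, IsOpen {x | ρ x ≤ k}) :
    ∃ F : ℕ → Set X, (∀ n, IsClosed (F n)) ∧ (∀ n, ∀ x ∈ F n, ρ x ≤ n) ∧ ∀ x, ∃ n, x ∈ F n := by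
  classical
  let V := Viter G ρ
  let Ch : (ℕ → X) → Prop := fun c =>
    StrictMono (fun i => ρ (c i)) ∧ ∀ i j, i < j → c i ∈ V 4 (c j)
  let Ind : (ℕ → X) → (ℕ → X) → Prop := fun c d =>
    ∃ m, ∀ i j, m ≤ i → m ≤ j → ∀ z, z ∈ V 3 (c i) → z ∉ V 3 (d j)
  have hsymm : ∀ c d, Ind c d → Ind d c := by
    rintro c d ⟨m, hm⟩
    exact ⟨m, fun i j hi hj z hz hz' => hm j i hj hi z hz' hz⟩
  obtain ⟨E, hE⟩ := zorn_subset {E : Set (ℕ → X) | (∀ c ∈ E, Ch c) ∧ E.Pairwise Ind} (by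
    intro C hC hch
    refine ⟨⋃₀ C, ⟨?_, ?_⟩, fun s hs => subset_sUnion_of_mem hs⟩
    · rintro c ⟨s, hs, hcs⟩
      exact (hC hs).1 c hcs
    · exact (pairwise_sUnion hch.directedOn).2 fun s hs => (hC hs).2)
  have hECh := hE.prop.1
  have hEInd := hE.prop.2
  have hmax : ∀ w, Ch w → ∃ c ∈ E, ¬ Ind w c := by
    intro w hw
    by_contra! hcon
    have hins : insert w E ∈ {E : Set (ℕ → X) | (∀ c ∈ E, Ch c) ∧ E.Pairwise Ind} := by
      refine ⟨?_, ?_⟩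
      · rintro c (rfl | hc)
        · exact hw
        · exact hECh c hc
      · exact hEInd.insert fun c hc _ => ⟨hcon c hc, hsymm _ _ (hcon c hc)⟩
    have hwE : w ∈ E := hE.le_of_ge hins (subset_insert w E) (mem_insert w E)
    obtain ⟨m, hm⟩ := hcon w hwE
    exact hm m m le_rfl le_rfl (w m) (viter_basic hG hρ 3 _).2 (viter_basic hG hρ 3 _).2
  have hlate : ∀ c, Ch c → ∀ n m, ∃ j, m < j ∧ n < ρ (c j) := by
    intro c hc n m
    refine ⟨max n m + 1, by omega, ?_⟩
    have : max n m + 1 ≤ ρ (c (max n m + 1)) := hc.1.le_apply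
    omega
  -- each point has a neighbourhood meeting only one chain
  have hone : ∀ p, ∀ c ∈ E, ∀ d ∈ E, ∀ i i', c i ∈ V 4 p → d i' ∈ V 4 p → c = d := by
    intro p c hc d hd i i' hci hdi
    by_contra hne
    obtain ⟨m, hm⟩ := hEInd hc hd hne
    obtain ⟨j, hj, hj'⟩ := hlate c (hECh c hc) (ρ p) (max i m)
    obtain ⟨k, hk, hk'⟩ := hlate d (hECh d hd) (ρ p) (max i' m)
    refine hm j k (by omega) (by omega) p ?_ ?_
    · exact viter_meet_lt hG hρ hci ((hECh c hc).2 i j (by omega)) hj'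
    · exact viter_meet_lt hG hρ hdi ((hECh d hd).2 i' k (by omega)) hk'
  let Es : Set X := {x | ∃ c ∈ E, ∃ i, c i = x}
  have hfin : ∀ p, (V 4 p ∩ Es).Finite := by
    intro p
    by_cases hemp : ∃ c ∈ E, ∃ i, c i ∈ V 4 p
    · obtain ⟨c, hc, i, hi⟩ := hemp
      refine (Set.Finite.image c (Set.finite_Iic (ρ p))).subset ?_
      rintro x ⟨hx, d, hd, j, rfl⟩
      obtain rfl := hone p c hc d hd i j hi hx
      refine ⟨j, ?_, rfl⟩
      have h1 := viter_rank hG hρ hx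
      have h2 := (hECh c hc).1.le_apply (x := j)
      exact le_trans h2 h1
    · convert Set.finite_empty
      ext x
      constructor
      · rintro ⟨hx, d, hd, j, rfl⟩
        exact hemp ⟨d, hd, j, hx⟩
      · exact fun h => h.elim
  have hclosed : ∀ A ⊆ Es, IsClosed A := by
    intro A hA
    rw [← isOpen_compl_iff, isOpen_iff_mem_nhds]
    intro p hp
    have hf : (V 4 p ∩ A).Finite := (hfin p).subset (inter_subset_inter_right _ hA)
    have ho : IsOpen (V 4 p \ (V 4 p ∩ A)) := (viter_basic hG hρ 4 p).1.sdiff hf.isClosed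
    refine Filter.mem_of_superset (ho.mem_nhds ⟨(viter_basic hG hρ 4 p).2, fun h => hp h.2⟩) ?_
    intro x hx hxA
    exact hx.2 ⟨hx.1, hxA⟩
  let O : X → Set X := fun w => {x | ρ x ≤ ρ w} \ {x | x ∈ Es ∧ ρ x < ρ w}
  have hO : ∀ w, IsOpen (O w) ∧ w ∈ O w := fun w =>
    ⟨(hρ _).sdiff (hclosed _ fun x hx => hx.1), le_refl (ρ w), fun h => lt_irrefl _ h.2⟩
  have hGO : ∀ w, IsOpen (G w (O w)) ∧ w ∈ G w (O w) ∧ G w (O w) ⊆ O w := fun w =>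
    hG.1 w _ (hO w).1 (hO w).2
  have hGGO : ∀ w, IsOpen (G w (G w (O w))) ∧ w ∈ G w (G w (O w)) ∧ _ := fun w =>
    hG.1 w _ (hGO w).1 (hGO w).2.1
  let V' : X → Set X := fun w => V 5 w ∩ G w (G w (O w))
  have hV'o : ∀ w, IsOpen (V' w) := fun w => (viter_basic hG hρ 5 w).1.inter (hGGO w).1
  have hV'm : ∀ w, w ∈ V' w := fun w => ⟨(viter_basic hG hρ 5 w).2, (hGGO w).2.1⟩
  refine ⟨fun n => (⋃ w ∈ {w | n < ρ w}, V' w)ᶜ, ?_, ?_, ?_⟩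
  · intro n
    exact (isOpen_biUnion fun w _ => hV'o w).isClosed_compl
  · intro n x hx
    by_contra hlt
    exact hx (mem_biUnion (not_le.1 hlt) (hV'm x))
  · intro z
    by_contra! hcon
    have hz : ∀ n, ∃ w, n < ρ w ∧ z ∈ V' w := by
      intro n
      have := hcon n
      simpa using this
    choose f hf hf' using hz
    -- build the chain
    let a : ℕ → ℕ := fun n => Nat.rec 0 (fun _ m => ρ (f m)) n
    have ha : ∀ n, a (n + 1) = ρ (f (a n)) := fun n => rfl
    let w : ℕ → X := fun n => f (a n)
    have hwmono : StrictMono (fun i => ρ (w i)) := by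
      apply strictMono_nat_of_lt_succ
      intro n
      change ρ (f (a n)) < ρ (f (a (n + 1)))
      rw [← ha n]
      exact hf _
    have hzw : ∀ i, z ∈ V' (w i) := fun i => hf' _
    have hw : Ch w := ⟨hwmono, fun i j hij =>
      viter_meet_lt hG hρ (hzw i).1 (hzw j).1 (hwmono hij)⟩
    obtain ⟨c, hc, hnind⟩ := hmax w hw
    have : ∃ i j x, x ∈ V 3 (w i) ∧ x ∈ V 3 (c j) := by
      by_contra! h
      exact hnind ⟨0, fun i j _ _ x hx => h i j x hx⟩
    obtain ⟨i, j, x, hx, hx'⟩ := this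
    have hy : ∃ j, w i ∈ V 1 (c j) := by
      rcases viter_meet hG hρ hx hx' with h | h
      · exact ⟨j, viter_succ_subset hG hρ 1 _ h⟩
      · obtain ⟨k, hk, hk'⟩ := hlate c (hECh c hc) (ρ (w i)) j
        have h4 := (hECh c hc).2 j k hk
        exact ⟨k, viter_meet_lt hG hρ h (viter_anti hG hρ (by norm_num) _ h4) hk'⟩
    obtain ⟨j, hj⟩ := hy
    obtain ⟨l, hl, hl'⟩ := hlate w hw (ρ (c j)) i
    have hmem : w i ∈ G (w l) (O (w l)) := by
      have hb := viter_basic hG hρ 4 (w i)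
      rcases hG.2 (w i) _ (w l) _ hb.1 hb.2 (hGO _).1 (hGO _).2.1 ⟨z, (hzw i).1, (hzw l).2⟩
        with h | h
      · exact h
      · exact absurd (viter_rank hG hρ h) (not_le.2 (hwmono hl))
    have hb := viter_basic hG hρ 0 (c j)
    rcases hG.2 (c j) _ (w l) _ hb.1 hb.2 (hO _).1 (hO _).2 ⟨w i, hj, hmem⟩ with h | h
    · exact h.2 ⟨⟨c, hc, j, rfl⟩, hl'⟩
    · exact absurd (viter_rank hG hρ h) (not_le.2 hl')

section Lin

variable {K : Type u} [LinearOrder K] [WellFoundedLT K]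

lemma exists_seq {κ : Cardinal.{u}}
    (hbdd : ∀ s : Set K, #s < κ → ∃ k, ∀ j ∈ s, j < k) (hini : ∀ k : K, #(Iio k) < κ)
    (ρ : X → K) (Q : K → X → Prop) (hQ : ∀ k, ∃ x, k < ρ x ∧ Q k x) :
    ∃ (g : K → X) (h : K → K), ∀ k, Q (h k) (g k) ∧ k ≤ h k ∧ h k < ρ (g k) ∧
      ∀ j < k, ρ (g j) ≤ h k := by
  choose c hc hc' using hQ
  have hb : ∀ (k : K) (φ : Iio k → K), ∃ b, ∀ j, φ j < b := by
    intro k φ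
    obtain ⟨b, hb⟩ := hbdd (range φ) (mk_range_le.trans_lt (hini k))
    exact ⟨b, fun j => hb _ ⟨j, rfl⟩⟩
  choose B hB using hb
  let h : K → K := wellFounded_lt.fix fun k ih => max k (B k fun j => ρ (c (ih j.1 j.2)))
  have hh : ∀ k, h k = max k (B k fun j : Iio k => ρ (c (h j.1))) := fun k =>
    wellFounded_lt.fix_eq _ k
  refine ⟨fun k => c (h k), h, fun k => ⟨hc' _, ?_, hc _, ?_⟩⟩
  · rw [hh]; exact le_max_left _ _
  · intro j hj
    rw [hh k]
    exact ((hB k (fun j : Iio k => ρ (c (h j.1))) ⟨j, hj⟩).le).trans (le_max_right _ _)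

lemma exists_acc (hwll : WeaklyLinearlyLindelof X) {G : X → Set X → Set X} (hG : IsMNOp G)
    {κ : Cardinal.{u}} (hreg : κ.IsRegular) (hunc : ℵ₀ < κ) (hK : #K = κ)
    (hini : ∀ k : K, #(Iic k) < κ)
    (ρ : X → K) (hρ : ∀ k, IsOpen {x | ρ x ≤ k}) (g : K → X)
    (hg : StrictMono (fun k => ρ (g k))) (N : K → Set X) (hN : ∀ k, IsOpen (N k))
    (hgN : ∀ k, g k ∈ N k) (hNρ : ∀ k, ∀ x ∈ N k, ρ x ≤ ρ (g k)) :
    ∃ z, ∀ k, ∃ k', k < k' ∧ z ∈ N k' := by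
  have hV : ∀ k, IsOpen (G (g k) (N k)) ∧ g k ∈ G (g k) (N k) ∧ G (g k) (N k) ⊆ N k :=
    fun k => hG.1 _ _ (hN k) (hgN k)
  let V : K → Set X := fun k => G (g k) (N k)
  have hVinj : Function.Injective V := by
    have key : ∀ j k, j < k → V j ≠ V k := by
      intro j k hjk he
      have h1 : g k ∈ V j := he ▸ (hV k).2.1
      exact absurd (hNρ j _ ((hV j).2.2 h1)) (not_le.2 (hg hjk))
    intro j k he
    rcases lt_trichotomy j k with h | h | h
    · exact absurd he (key _ _ h)
    · exact h
    · exact absurd he.symm (key _ _ h)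
  obtain ⟨z, hz⟩ := hwll κ hreg hunc (range V)
    (by rintro _ ⟨k, rfl⟩; exact ⟨(hV k).1, _, (hV k).2.1⟩)
    (by rw [mk_range_eq V hVinj, hK])
  refine ⟨z, fun k => ?_⟩
  obtain ⟨hGo, hGm, -⟩ := hG.1 z _ (hρ (ρ z)) (le_refl (ρ z))
  have hcard := hz _ (hGo.mem_nhds hGm)
  by_contra! hcon
  have hsub : {U | U ∈ range V ∧ (U ∩ G z {x | ρ x ≤ ρ z}).Nonempty} ⊆
      V '' (Iic (max k (ρ z))) := by
    rintro _ ⟨⟨k', rfl⟩, hne⟩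
    refine ⟨k', ?_, rfl⟩
    by_contra hlt
    have hlt : max k (ρ z) < k' := not_le.1 hlt
    rcases hG.2 (g k') _ z _ (hN k') (hgN k') (hρ _) (le_refl (ρ z)) hne with h | h
    · have h1 : k' ≤ ρ (g k') := hg.le_apply
      have h2 : ρ (g k') ≤ ρ z := h
      exact absurd (h1.trans h2) (not_le.2 ((le_max_right _ _).trans_lt hlt))
    · exact hcon k' ((le_max_left _ _).trans_lt hlt) h
  have := (mk_le_mk_of_subset hsub).trans mk_image_le
  rw [hcard] at this
  exact absurd (hini _) (not_lt.2 this)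

/-- Linear Lindelöfness in terms of rank functions. -/
lemma rank_bounded [T1Space X] (hwll : WeaklyLinearlyLindelof X) {G : X → Set X → Set X}
    (hG : IsMNOp G) {κ : Cardinal.{u}} (hreg : κ.IsRegular) (hunc : ℵ₀ < κ) (hK : #K = κ)
    (hbdd : ∀ s : Set K, #s < κ → ∃ k, ∀ j ∈ s, j < k) (hini : ∀ k : K, #(Iic k) < κ)
    (ρ : X → K) (hρ : ∀ k, IsOpen {x | ρ x ≤ k}) : ∃ k, ∀ x, ρ x ≤ k := by
  by_contra! hub
  have hini' : ∀ k : K, #(Iio k) < κ := fun k =>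
    (mk_le_mk_of_subset Iio_subset_Iic_self).trans_lt (hini k)
  have hsm : ∀ (g : K → X) (h : K → K), (∀ k, h k < ρ (g k)) →
      (∀ k, ∀ j < k, ρ (g j) ≤ h k) → StrictMono (fun k => ρ (g k)) :=
    fun g h h1 h2 j k hjk => (h2 k j hjk).trans_lt (h1 k)
  obtain ⟨g, h, hgh⟩ := exists_seq hbdd hini' ρ (fun _ _ => True) (fun k => by
    obtain ⟨x, hx⟩ := hub k
    exact ⟨x, hx, trivial⟩)
  obtain ⟨z, hz⟩ := exists_acc hwll hG hreg hunc hK hini ρ hρ g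
    (hsm g h (fun k => (hgh k).2.2.1) (fun k => (hgh k).2.2.2))
    (fun k => Viter G ρ 2 (g k)) (fun k => (viter_basic hG hρ 2 _).1)
    (fun k => (viter_basic hG hρ 2 _).2) (fun k x hx => viter_rank hG hρ hx)
  let S : Set X := {y | z ∈ Viter G ρ 2 y}
  have hS : ∀ k, ∃ y ∈ S, k < ρ y := by
    intro k
    obtain ⟨k', hk', hzk⟩ := hz k
    exact ⟨g k', hzk, (hk'.trans_le (hgh k').2.1).trans (hgh k').2.2.1⟩
  have hdense : ∃ k, S ⊆ closure (S ∩ {x | ρ x ≤ k}) := by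
    by_contra! hnd
    obtain ⟨g, h, hgh⟩ := exists_seq hbdd hini' ρ
      (fun k y => y ∈ S ∧ y ∉ closure (S ∩ {x | ρ x ≤ k})) (fun k => by
        obtain ⟨y, hy, hy'⟩ := not_subset.1 (hnd k)
        refine ⟨y, ?_, hy, hy'⟩
        by_contra hle
        exact hy' (subset_closure ⟨hy, not_lt.1 hle⟩))
    let A : K → Set X := fun k => {x | ρ x ≤ ρ (g k)} \ closure (S ∩ {x | ρ x ≤ h k})
    have hA : ∀ k, IsOpen (A k) ∧ g k ∈ A k := fun k =>
      ⟨(hρ _).sdiff isClosed_closure, le_refl (ρ (g k)), (hgh k).1.2⟩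
    have hGA : ∀ k, IsOpen (G (g k) (A k)) ∧ g k ∈ G (g k) (A k) ∧ G (g k) (A k) ⊆ A k :=
      fun k => hG.1 _ _ (hA k).1 (hA k).2
    obtain ⟨p, hp⟩ := exists_acc hwll hG hreg hunc hK hini ρ hρ g
      (hsm g h (fun k => (hgh k).2.2.1) (fun k => (hgh k).2.2.2))
      (fun k => G (g k) (A k)) (fun k => (hGA k).1) (fun k => (hGA k).2.1)
      (fun k x hx => ((hGA k).2.2 hx).1)
    obtain ⟨j, -, hj⟩ := hp (ρ z)
    obtain ⟨k, hjk, hk⟩ := hp j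
    rcases hG.2 _ _ _ _ (hA j).1 (hA j).2 (hA k).1 (hA k).2 ⟨p, hj, hk⟩ with h' | h'
    · exact h'.2 (subset_closure ⟨(hgh j).1.1, (hgh k).2.2.2 j hjk⟩)
    · exact absurd (((hgh k).2.2.2 j hjk).trans_lt (hgh k).2.2.1) (not_lt.2 h'.1)
  obtain ⟨k, hk⟩ := hdense
  obtain ⟨y, hyS, hy⟩ := hS k
  obtain ⟨y', hyS', hy'⟩ := hS (ρ y)
  have hne : y' ∈ ({y}ᶜ : Set X) := by
    rintro rfl
    exact lt_irrefl _ hy'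
  obtain ⟨hGo, hGm, -⟩ := hG.1 y' {y}ᶜ isOpen_compl_singleton hne
  obtain ⟨s, hs, hsS, hsk⟩ := mem_closure_iff.1 (hk hyS') _ hGo hGm
  have h1 : s ∈ Viter G ρ 1 y := viter_meet_lt hG hρ hsS hyS (lt_of_le_of_lt hsk hy)
  have hb := viter_basic hG hρ 0 y
  rcases hG.2 y _ y' _ hb.1 hb.2 isOpen_compl_singleton hne ⟨s, h1, hs⟩ with h' | h'
  · exact h' rfl
  · exact absurd (viter_rank hG hρ h') (not_le.2 hy')

end Lin

/-- Rank function attached to a cofinal map and an open cover of a closed set. -/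
lemma exists_rank {ι K : Type*} [LinearOrder ι] [LinearOrder K] [WellFoundedLT K] (f : K → ι)
    (hf : ∀ i, ∃ k, i ≤ f k) (k₀ : K) (U : ι → Set X) (hU : ∀ i, IsOpen (U i)) (F : Set X)
    (hF : IsClosed F) (hFU : F ⊆ ⋃ i, U i) :
    ∃ ρ : X → K, (∀ k, IsOpen {x | ρ x ≤ k}) ∧
      ∀ x ∈ F, ∀ k, ρ x ≤ k → ∃ j ≤ k, ∃ i ≤ f j, x ∈ U i := by
  have hne : ∀ x, ({k | x ∉ F ∨ ∃ i ≤ f k, x ∈ U i} : Set K).Nonempty := by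
    intro x
    by_cases hx : x ∈ F
    · obtain ⟨i, hi⟩ := mem_iUnion.1 (hFU hx)
      obtain ⟨k, hk⟩ := hf i
      exact ⟨k, Or.inr ⟨i, hk, hi⟩⟩
    · exact ⟨k₀, Or.inl hx⟩
  let ρ : X → K := fun x => wellFounded_lt.min _ (hne x)
  have hρ : ∀ x, x ∉ F ∨ ∃ i ≤ f (ρ x), x ∈ U i := fun x => wellFounded_lt.min_mem _ (hne x)
  have hρ' : ∀ x k, (x ∉ F ∨ ∃ i ≤ f k, x ∈ U i) → ρ x ≤ k := fun x k h =>
    not_lt.1 (wellFounded_lt.not_lt_min {k | x ∉ F ∨ ∃ i ≤ f k, x ∈ U i} h)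
  refine ⟨ρ, fun k => ?_, fun x hx k hk => ⟨ρ x, hk, (hρ x).resolve_left (not_not.2 hx)⟩⟩
  have : {x | ρ x ≤ k} = ⋃ j ∈ Iic k, (Fᶜ ∪ ⋃ i ∈ Iic (f j), U i) := by
    ext x
    simp only [mem_ofPred_eq, mem_iUnion, mem_Iic, mem_union, mem_compl_iff, exists_prop]
    exact ⟨fun h => ⟨ρ x, h, hρ x⟩, fun ⟨j, hj, h⟩ => (hρ' x j h).trans hj⟩
  rw [this]
  exact isOpen_biUnion fun j _ => hF.isOpen_compl.union (isOpen_biUnion fun i _ => hU i)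

lemma mk_Iic_ord_lt {c : Cardinal.{u}} (hc : ℵ₀ ≤ c) (k : c.ord.ToType) : #(Iic k) < c := by
  have h : #(Iio k) < c := by
    have := mk_Iio_lt k (by rw [mk_ord_toType, Ordinal.type_toType])
    rwa [mk_ord_toType] at this
  rw [← Iio_insert]
  exact (mk_insert_le).trans_lt (add_lt_of_lt hc h (one_lt_aleph0.trans_le hc))

lemma countable_subcover [T1Space X] (hwll : WeaklyLinearlyLindelof X) {G : X → Set X → Set X}
    (hG : IsMNOp G) (lam : Cardinal.{u}) : ∀ (ι : Type u), #ι = lam → ∀ (U : ι → Set X),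
      (∀ i, IsOpen (U i)) → ∀ F : Set X, IsClosed F → F ⊆ ⋃ i, U i →
      ∃ t : Set ι, t.Countable ∧ F ⊆ ⋃ i ∈ t, U i := by
  induction lam using WellFoundedLT.induction with
  | ind lam ih =>
  suffices H : ∀ (U : lam.ord.ToType → Set X),
      (∀ i, IsOpen (U i)) → ∀ F : Set X, IsClosed F → F ⊆ ⋃ i, U i →
      ∃ t : Set lam.ord.ToType, t.Countable ∧ F ⊆ ⋃ i ∈ t, U i by
    intro ι hι U hU F hF hFU
    obtain ⟨e⟩ : Nonempty (lam.ord.ToType ≃ ι) := by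
      rw [← Cardinal.eq, hι, mk_ord_toType]
    obtain ⟨t, ht, htF⟩ := H (fun i => U (e i)) (fun i => hU _) F hF (fun x hx => by
      obtain ⟨i, hi⟩ := mem_iUnion.1 (hFU hx)
      exact mem_iUnion.2 ⟨e.symm i, by simpa using hi⟩)
    refine ⟨e '' t, ht.image _, fun x hx => ?_⟩
    obtain ⟨i, hi, hxi⟩ := mem_iUnion₂.1 (htF hx)
    exact mem_iUnion₂.2 ⟨e i, ⟨i, hi, rfl⟩, hxi⟩
  intro U hU F hF hFU
  rcases le_or_gt lam ℵ₀ with hle | hgt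
  · refine ⟨univ, ?_, by simpa using hFU⟩
    rw [countable_univ_iff, ← mk_le_aleph0_iff, mk_ord_toType]
    exact hle
  let ι := lam.ord.ToType
  have hIic : ∀ b : ι, #(Iic b) < lam := mk_Iic_ord_lt hgt.le
  have hbounded : ∀ b : ι, ∀ F' : Set X, IsClosed F' → (∀ x ∈ F', ∃ i ≤ b, x ∈ U i) →
      ∃ t : Set ι, t.Countable ∧ F' ⊆ ⋃ i ∈ t, U i := by
    intro b F' hF' hcov
    obtain ⟨t, ht, htF⟩ := ih _ (hIic b) (Iic b) rfl (fun i => U i.1) (fun i => hU _) F' hF'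
      (fun x hx => by
        obtain ⟨i, hi, hx⟩ := hcov x hx
        exact mem_iUnion.2 ⟨⟨i, hi⟩, hx⟩)
    refine ⟨Subtype.val '' t, ht.image _, fun x hx => ?_⟩
    obtain ⟨i, hi, hxi⟩ := mem_iUnion₂.1 (htF hx)
    exact mem_iUnion₂.2 ⟨i.1, ⟨i, hi, rfl⟩, hxi⟩
  obtain ⟨s, hs, hscard⟩ := Order.exists_cof_eq ι
  have hlim : Order.IsSuccLimit lam.ord := isSuccLimit_ord hgt.le
  have hreg : (Order.cof ι).IsRegular := by
    rw [Ordinal.cof_toType]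
    exact Cardinal.isRegular_cof hlim
  have hsmall : ∀ r : Set ι, #r < Order.cof ι → ∃ b, ∀ j ∈ r, j < b := by
    intro r hr
    by_contra! hcon
    exact absurd (Order.cof_le (s := r) hcon) (not_le.2 hr)
  rcases hreg.aleph0_le.eq_or_lt with hω | hω
  · have : Nonempty (ℕ ≃ s) := by
      rw [← hω] at hscard
      obtain ⟨h⟩ := Cardinal.denumerable_iff.2 hscard
      exact ⟨(Denumerable.eqv s).symm⟩
    obtain ⟨e⟩ := this
    obtain ⟨ρ, hρ, hρF⟩ := exists_rank (fun n => (e n : ι)) (fun i => by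
      obtain ⟨j, hj, hij⟩ := hs i
      exact ⟨e.symm ⟨j, hj⟩, by simpa using hij⟩) 0 U hU F hF hFU
    obtain ⟨Fn, hFn, hFnρ, hFnc⟩ := mn_shrink hG ρ hρ
    have : ∀ n, ∃ t : Set ι, t.Countable ∧ F ∩ Fn n ⊆ ⋃ i ∈ t, U i := by
      intro n
      obtain ⟨b, hb⟩ := hsmall ((fun n => (e n : ι)) '' Iic n) (by
        rw [← hω]
        exact Cardinal.lt_aleph0_iff_set_finite.2 ((finite_Iic n).image _))
      refine hbounded b _ (hF.inter (hFn n)) fun x hx => ?_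
      obtain ⟨j, hj, i, hi, hxi⟩ := hρF x hx.1 n (hFnρ n x hx.2)
      exact ⟨i, hi.trans (hb _ ⟨j, hj, rfl⟩).le, hxi⟩
    choose t ht htF using this
    refine ⟨⋃ n, t n, countable_iUnion ht, fun x hx => ?_⟩
    obtain ⟨n, hn⟩ := hFnc x
    obtain ⟨i, hi, hxi⟩ := mem_iUnion₂.1 (htF n ⟨hx, hn⟩)
    exact mem_iUnion₂.2 ⟨i, mem_iUnion.2 ⟨n, hi⟩, hxi⟩
  · set κ := Order.cof ι with hκ
    let K := κ.ord.ToType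
    obtain ⟨e⟩ : Nonempty (K ≃ s) := by
      rw [← Cardinal.eq, hscard, mk_ord_toType]
    have hKini : ∀ k : K, #(Iic k) < κ := mk_Iic_ord_lt hω.le
    have hKb : ∀ s : Set K, #s < κ → ∃ k, ∀ j ∈ s, j < k := by
      intro r hr
      by_contra! hcon
      have h1 : Order.cof K ≤ #r := Order.cof_le (s := r) hcon
      rw [Ordinal.cof_toType, hreg.cof_ord] at h1
      exact absurd h1 (not_le.2 hr)
    obtain ⟨k₀, -⟩ := hKb ∅ (by simpa using hreg.pos)
    obtain ⟨ρ, hρ, hρF⟩ := exists_rank (fun n => (e n : ι)) (fun i => by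
      obtain ⟨j, hj, hij⟩ := hs i
      exact ⟨e.symm ⟨j, hj⟩, by simpa using hij⟩) k₀ U hU F hF hFU
    obtain ⟨k, hk⟩ := rank_bounded hwll hG hreg hω (mk_ord_toType κ) hKb hKini ρ hρ
    obtain ⟨b, hb⟩ := hsmall ((fun n => (e n : ι)) '' Iic k) (mk_image_le.trans_lt (hKini k))
    refine hbounded b F hF fun x hx => ?_
    obtain ⟨j, hj, i, hi, hxi⟩ := hρF x hx k (hk x)
    exact ⟨i, hi.trans (hb _ ⟨j, hj, rfl⟩).le, hxi⟩

end Helpers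

/-- Every weakly linearly Lindelöf monotonically normal space is Lindelöf. -/
theorem weaklyLinearlyLindelof_monotonicallyNormal_lindelof (X : Type u)
    [TopologicalSpace X] (hwll : WeaklyLinearlyLindelof X)
    (hmn : MonotonicallyNormal X) : LindelofSpace X := by
  obtain ⟨hT1, G, hG⟩ := hmn
  refine ⟨isLindelof_of_countable_subcover fun {ι} U hU hcov => ?_⟩
  exact countable_subcover hwll hG _ ι rfl U hU _ isClosed_univ hcov
end

section
/- Every first countable, almost discretely Lindelöf, regular Hausdorff (T3) topological space has cardinality at most the continuum 2^{ℵ0}. -/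
universe u

open Cardinal

/-- A space is almost discretely Lindelöf if every subset that is discrete in the
subspace topology is contained in a Lindelöf subspace. -/
def AlmostDiscretelyLindelof (X : Type u) [TopologicalSpace X] : Prop :=
  ∀ D : Set X, DiscreteTopology ↥D → ∃ L : Set X, D ⊆ L ∧ IsLindelof L


theorem exists_closing {X K : Type u} (hK : #K ≤ 𝔠) (op : K → (ℕ → X) → X) (a0 : X) :
    ∃ F : Set X, a0 ∈ F ∧ #F ≤ 𝔠 ∧ ∀ k s, (∀ n, s n ∈ F) → op k s ∈ F := by
  let β : Option K → Type := fun o => match o with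
    | none => Empty
    | some _ => ℕ
  let ev : WType β → X := WType.elim X (fun p => match p with
    | ⟨none, _⟩ => a0
    | ⟨some k, s⟩ => op k s)
  have hcard : #(WType β) ≤ 𝔠 := by
    apply WType.cardinalMk_le_of_le'
    refine (Cardinal.sum_le_mk_mul_iSup _).trans ?_
    have h1 : #(Option K) ≤ 𝔠 := by
      rw [Cardinal.mk_option]
      exact (add_le_add hK Cardinal.one_lt_aleph0.le).trans (by simp)
    have h2 : (⨆ a : Option K, (𝔠 : Cardinal.{u}) ^ Cardinal.lift.{u} #(β a)) ≤ 𝔠 := by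
      apply ciSup_le'
      rintro (_ | k)
      · simp [β]
        exact Cardinal.one_lt_aleph0.le.trans Cardinal.aleph0_le_continuum
      · simp [β]
    exact (mul_le_mul' h1 h2).trans (by simp)
  refine ⟨Set.range ev, ⟨WType.mk none Empty.elim, rfl⟩, Cardinal.mk_range_le.trans hcard, ?_⟩
  intro k s hs
  choose t ht using hs
  refine ⟨WType.mk (some k) t, ?_⟩
  have : s = fun n => ev (t n) := by ext n; exact (ht n).symm
  rw [this]
  rfl

theorem exists_omega1 : ∃ (I : Type) (_ : LinearOrder I) (_ : WellFoundedLT I),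
    (∀ i : I, (Set.Iio i).Countable) ∧ Uncountable I := by
  refine ⟨(Cardinal.aleph 1).ord.ToType, inferInstance, inferInstance, ?_, ?_⟩
  · intro i
    have := Cardinal.mk_Iio_toType_ord_lt i
    rw [← Cardinal.le_aleph0_iff_set_countable]
    rwa [← Order.lt_succ_iff, ← Cardinal.aleph_zero, ← Cardinal.aleph_succ, Ordinal.succ_zero]
  · rw [← Cardinal.aleph0_lt_mk_iff]
    simp

section
variable {I : Type} [LinearOrder I] [WellFoundedLT I]

theorem exists_bound (hI : ∀ i : I, (Set.Iio i).Countable) (hu : Uncountable I)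
    {S : Set I} (hS : S.Countable) : ∃ a, ∀ s ∈ S, s < a := by
  by_contra! hcon
  have : (Set.univ : Set I) ⊆ ⋃ s ∈ S, Set.Iic s := by
    intro a _
    obtain ⟨s, hs, h⟩ := hcon a
    simp only [Set.mem_iUnion]
    exact ⟨s, hs, h⟩
  have h2 : (⋃ s ∈ S, Set.Iic s).Countable := by
    refine hS.biUnion fun s _ => ?_
    rw [← Set.Iio_insert]
    exact (hI s).insert s
  exact Set.not_countable_univ (h2.mono this)

/-- No free sequence of length `ω₁`. -/
theorem no_free {X : Type u} [TopologicalSpace X] [FirstCountableTopology X]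
    (hI : ∀ i : I, (Set.Iio i).Countable) (hu : Uncountable I) (x : I → X)
    (hx : ∀ a, Disjoint (closure (x '' Set.Iio a)) (closure (x '' Set.Ici a)))
    (hL : ∀ D : Set X, DiscreteTopology ↥D → ∃ L : Set X, D ⊆ L ∧ IsLindelof L) : False := by
  obtain ⟨L, hDL, hL⟩ := hL (Set.range x) (by
    rw [discreteTopology_subtype_iff']
    rintro _ ⟨a, rfl⟩
    obtain ⟨b0, hb0⟩ := exists_bound hI hu (Set.countable_singleton a)
    have hne : (Set.Ioi a).Nonempty := ⟨b0, hb0 a rfl⟩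
    set b := wellFounded_lt.min (Set.Ioi a) hne with hb
    have hab : a < b := wellFounded_lt.min_mem _ hne
    refine ⟨(closure (x '' Set.Iio a))ᶜ ∩ (closure (x '' Set.Ici b))ᶜ,
      isClosed_closure.isOpen_compl.inter isClosed_closure.isOpen_compl, ?_⟩
    have ha1 : x a ∉ closure (x '' Set.Iio a) := fun h =>
      (hx a).le_bot ⟨h, subset_closure ⟨a, le_rfl, rfl⟩⟩
    have ha2 : x a ∉ closure (x '' Set.Ici b) := fun h =>
      (hx b).le_bot ⟨subset_closure ⟨a, hab, rfl⟩, h⟩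
    ext y
    constructor
    · rintro ⟨⟨h1, h2⟩, ⟨c, rfl⟩⟩
      rcases lt_trichotomy c a with h | h | h
      · exact absurd (subset_closure ⟨c, h, rfl⟩ : x c ∈ closure (x '' Set.Iio a)) h1
      · rw [h]; rfl
      · have hbc : b ≤ c := not_lt.1 (wellFounded_lt.not_lt_min _ (x := c) h)
        exact absurd (subset_closure (Set.mem_image_of_mem x hbc)) h2
    · rintro rfl
      exact ⟨⟨ha1, ha2⟩, a, rfl⟩)
  obtain ⟨z, hzL, hz⟩ : (L ∩ ⋂ a, closure (x '' Set.Ici a)).Nonempty := by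
    by_contra hemp
    rw [Set.not_nonempty_iff_eq_empty] at hemp
    obtain ⟨v, hv, hve⟩ := hL.elim_countable_subfamily_closed
      (fun a => closure (x '' Set.Ici a)) (fun a => isClosed_closure) hemp
    obtain ⟨a, ha⟩ := exists_bound hI hu hv
    have hmem : x a ∈ L ∩ ⋂ i ∈ v, closure (x '' Set.Ici i) := by
      refine ⟨hDL ⟨a, rfl⟩, ?_⟩
      simp only [Set.mem_iInter]
      intro i hi
      exact subset_closure ⟨a, (ha i hi).le, rfl⟩
    rw [hve] at hmem
    exact hmem
  rw [Set.mem_iInter] at hz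
  have := hu
  obtain ⟨i0⟩ : Nonempty I := inferInstance
  obtain ⟨s, hs, hst⟩ := mem_closure_iff_seq_limit.1 (hz i0)
  choose c hc hcs using hs
  obtain ⟨a, ha⟩ := exists_bound hI hu (Set.countable_range c)
  refine (hx a).le_bot ⟨?_, hz a⟩
  refine mem_closure_iff_seq_limit.2 ⟨s, fun n => ⟨c n, ha _ ⟨n, rfl⟩, hcs n⟩, hst⟩

end

theorem mk_seq_le {A : Type u} (hA : #A ≤ 𝔠) : #(ℕ → A) ≤ 𝔠 := by
  rw [Cardinal.mk_arrow]
  simp only [Cardinal.lift_uzero, Cardinal.mk_nat, Cardinal.lift_aleph0]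
  exact (Cardinal.power_le_power_right hA).trans (by simp)

theorem mk_closure_le {X : Type u} [TopologicalSpace X] [FirstCountableTopology X] [T2Space X]
    (A : Set X) (hA : #A ≤ 𝔠) : #(closure A) ≤ 𝔠 := by
  have h : ∀ z : closure A, ∃ s : ℕ → A, Filter.Tendsto (fun n => (s n : X)) Filter.atTop (nhds z) := by
    intro z
    obtain ⟨s, hs, hst⟩ := mem_closure_iff_seq_limit.1 z.2
    exact ⟨fun n => ⟨s n, hs n⟩, hst⟩
  choose s hs using h
  have inj : Function.Injective s := by
    intro z w hzw
    have h1 := hs z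
    rw [hzw] at h1
    exact Subtype.ext (tendsto_nhds_unique h1 (hs w))
  have := Cardinal.mk_le_of_injective inj
  exact this.trans (mk_seq_le hA)

/-- The closing-off argument. -/
theorem card_le_of_pseudo {X : Type u} [TopologicalSpace X] [FirstCountableTopology X] [T2Space X]
    (hG : ∀ s : ℕ → X, ∃ 𝒢 : Set (Set X), #𝒢 ≤ 𝔠 ∧
      (∀ G ∈ 𝒢, IsOpen G ∧ closure (Set.range s) ⊆ G) ∧
      ∀ p, p ∉ closure (Set.range s) → ∃ G ∈ 𝒢, p ∉ G)
    (hL : ∀ D : Set X, DiscreteTopology ↥D → ∃ L : Set X, D ⊆ L ∧ IsLindelof L) : #X ≤ 𝔠 := by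
  classical
  rcases isEmpty_or_nonempty X with hX | ⟨⟨a0⟩⟩
  · simp
  let J := ULift.{u} ℝ
  have hJ : #J = 𝔠 := by simp [J, Cardinal.mk_real]
  have hg : ∀ s : ℕ → X, ∃ g : J → Set X, (∀ j, IsOpen (g j) ∧ closure (Set.range s) ⊆ g j) ∧
      ∀ p, p ∉ closure (Set.range s) → ∃ j, p ∉ g j := by
    intro s
    obtain ⟨𝒢, hc, h1, h2⟩ := hG s
    rw [← hJ, Cardinal.le_def] at hc
    obtain ⟨e⟩ := hc
    refine ⟨fun j => if h : ∃ G : 𝒢, e G = j then (h.choose : Set X) else Set.univ, ?_, ?_⟩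
    · intro j
      by_cases h : ∃ G : 𝒢, e G = j
      · simp only [dif_pos h]
        exact h1 _ h.choose.2
      · simp only [dif_neg h]
        exact ⟨isOpen_univ, Set.subset_univ _⟩
    · intro p hp
      obtain ⟨G, hG, hpG⟩ := h2 p hp
      refine ⟨e ⟨G, hG⟩, ?_⟩
      have h : ∃ G2 : 𝒢, e G2 = e ⟨G, hG⟩ := ⟨_, rfl⟩
      simp only [dif_pos h]
      rw [e.injective h.choose_spec]
      exact hpG
  choose g hg1 hg2 using hg
  let op : Option (ℕ → J) → (ℕ → X) → X := fun k s => match k with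
    | none => if h : ∃ z, Filter.Tendsto s Filter.atTop (nhds z) then h.choose else a0
    | some i => if h : ∃ z, ∀ n, z ∉ g (fun m => s (Nat.pair n m)) (i n) then h.choose else a0
  have hK : #(Option (ℕ → J)) ≤ 𝔠 := by
    rw [Cardinal.mk_option]
    exact (add_le_add (mk_seq_le hJ.le) Cardinal.one_lt_aleph0.le).trans (by simp)
  obtain ⟨F, ha0, hFc, hF⟩ := exists_closing hK op a0
  suffices hFu : F = Set.univ by
    rw [hFu, Cardinal.mk_univ] at hFc
    exact hFc
  have hFlim : ∀ s : ℕ → X, (∀ n, s n ∈ F) → ∀ z, Filter.Tendsto s Filter.atTop (nhds z) → z ∈ F := by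
    intro s hs z hz
    have h : ∃ z, Filter.Tendsto s Filter.atTop (nhds z) := ⟨z, hz⟩
    have h3 := hF none s hs
    simp only [op, dif_pos h] at h3
    rwa [tendsto_nhds_unique hz h.choose_spec]
  have hFcl : ∀ s : ℕ → X, (∀ n, s n ∈ F) → closure (Set.range s) ⊆ F := by
    intro s hs z hz
    obtain ⟨t, ht, htz⟩ := mem_closure_iff_seq_limit.1 hz
    refine hFlim t (fun n => ?_) z htz
    obtain ⟨m, hm⟩ := ht n
    rw [← hm]
    exact hs m
  have hFout : ∀ (s : ℕ → ℕ → X), (∀ n m, s n m ∈ F) → ∀ i : ℕ → J,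
      (∃ z, ∀ n, z ∉ g (s n) (i n)) → ∃ z ∈ F, ∀ n, z ∉ g (s n) (i n) := by
    intro s hs i hz
    let sq : ℕ → X := fun k => s k.unpair.1 k.unpair.2
    have hsq : ∀ n, (fun m => sq (Nat.pair n m)) = s n := by
      intro n
      ext m
      simp [sq]
    have h : ∃ z, ∀ n, z ∉ g (fun m => sq (Nat.pair n m)) (i n) := by
      simpa only [hsq] using hz
    have h3 := hF (some i) sq (fun n => hs _ _)
    simp only [op, dif_pos h] at h3
    refine ⟨_, h3, fun n => ?_⟩
    have := h.choose_spec n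
    rwa [hsq n] at this
  by_contra hne
  obtain ⟨p, hp⟩ := (Set.ne_univ_iff_exists_notMem F).1 hne
  -- neighbourhoods avoiding `p`
  have hGp : ∀ A : Set X, ∃ V : Set X, A.Countable → A.Nonempty → A ⊆ F →
      ∃ s : ℕ → X, ∃ j, Set.range s = A ∧ V = g s j ∧ p ∉ V := by
    intro A
    by_cases h : A.Countable ∧ A.Nonempty ∧ A ⊆ F
    · obtain ⟨s, hs⟩ := h.1.exists_eq_range h.2.1
      have hsF : ∀ n, s n ∈ F := fun n => h.2.2 (by rw [hs]; exact ⟨n, rfl⟩)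
      obtain ⟨j, hj⟩ := hg2 s p (fun hh => hp (hFcl s hsF hh))
      exact ⟨g s j, fun _ _ _ => ⟨s, j, hs.symm, rfl, hj⟩⟩
    · exact ⟨∅, fun h1 h2 h3 => absurd ⟨h1, h2, h3⟩ h⟩
  choose V hV using hGp
  have hVout : ∀ A : ℕ → Set X, (∀ n, (A n).Countable) → (∀ n, (A n).Nonempty) →
      (∀ n, A n ⊆ F) → ∃ z ∈ F, ∀ n, z ∉ V (A n) := by
    intro A h1 h2 h3
    choose s j hs hsV hpV using fun n => hV (A n) (h1 n) (h2 n) (h3 n)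
    obtain ⟨z, hz, hzn⟩ := hFout s (fun n m => h3 n (by rw [← hs]; exact ⟨m, rfl⟩)) j
      ⟨p, fun n => by rw [← hsV]; exact hpV n⟩
    exact ⟨z, hz, fun n => by rw [hsV]; exact hzn n⟩
  obtain ⟨I, _, _, hI, hu⟩ := exists_omega1
  have hstep : ∀ (a : I) (f : ∀ b, b < a → F), ∃ z : F, ∀ b, (hb : b ≤ a) →
      (z : X) ∉ V (insert a0 {y | ∃ c, ∃ hc : c < b, y = f c (hc.trans_le hb)}) := by
    intro a f
    have hcI : (Set.Iic a).Countable := by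
      rw [← Set.Iio_insert]
      exact (hI a).insert a
    obtain ⟨e, he⟩ := hcI.exists_eq_range ⟨a, le_rfl⟩
    have hea : ∀ n, e n ≤ a := fun n => by
      have : e n ∈ Set.Iic a := by rw [he]; exact ⟨n, rfl⟩
      exact this
    obtain ⟨z, hz, hzn⟩ := hVout
      (fun n => insert a0 {y | ∃ c, ∃ hc : c < e n, y = f c (hc.trans_le (hea n))})
      (fun n => by
        refine Set.Countable.insert _ ?_
        have := (hI (e n)).to_subtype
        refine (Set.countable_range
          (fun c : Set.Iio (e n) => (f c.1 (lt_of_lt_of_le c.2 (hea n)) : X))).mono ?_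
        rintro y ⟨c, hc, rfl⟩
        exact ⟨⟨c, hc⟩, rfl⟩)
      (fun n => Set.insert_nonempty _ _)
      (fun n => by
        refine Set.insert_subset ha0 ?_
        rintro y ⟨c, hc, rfl⟩
        exact (f c _).2)
    refine ⟨⟨z, hz⟩, fun b hb => ?_⟩
    obtain ⟨n, rfl⟩ : b ∈ Set.range e := by rw [← he]; exact hb
    exact hzn n
  choose nx hnx using hstep
  let x : I → F := (wellFounded_lt (α := I)).fix nx
  have hx : ∀ a, x a = nx a (fun b _ => x b) := fun a => (wellFounded_lt (α := I)).fix_eq nx a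
  have hxV : ∀ a b, b ≤ a → (x a : X) ∉ V (insert a0 ((fun c => (x c : X)) '' Set.Iio b)) := by
    intro a b hb
    have := hnx a (fun b _ => x b) b hb
    rw [← hx a] at this
    convert this using 4
    ext y
    simp only [Set.mem_image, Set.mem_Iio, Set.mem_setOf_eq]
    constructor
    · rintro ⟨c, hc, rfl⟩; exact ⟨c, hc, rfl⟩
    · rintro ⟨c, hc, rfl⟩; exact ⟨c, hc, rfl⟩
  refine no_free hI hu (fun a => (x a : X)) (fun a => ?_) hL
  obtain ⟨s, j, hs, hsV, -⟩ := hV (insert a0 ((fun c => (x c : X)) '' Set.Iio a))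
    (((hI a).image _).insert _) (Set.insert_nonempty _ _)
    (Set.insert_subset ha0 (by rintro y ⟨c, -, rfl⟩; exact (x c).2))
  have hop := hg1 s j
  rw [← hsV, hs] at hop
  refine Set.disjoint_left.2 fun z hz1 hz2 => ?_
  have hzV := hop.2 (closure_mono (Set.subset_insert _ _) hz1)
  obtain ⟨y, hyV, ⟨c, hc, rfl⟩⟩ := mem_closure_iff.1 hz2 _ hop.1 hzV
  exact hxV c a hc hyV

/-- The Arhangelskii theorem for first countable Lindelof Hausdorff spaces. -/
theorem card_le_of_lindelof {X : Type u} [TopologicalSpace X] [FirstCountableTopology X]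
    [T2Space X] [LindelofSpace X] : #X ≤ 𝔠 := by
  apply card_le_of_pseudo
  · intro s
    set E := closure (Set.range s) with hE
    have hEc : #E ≤ 𝔠 := mk_closure_le _
      ((Cardinal.le_aleph0_iff_set_countable.2 (Set.countable_range s)).trans
        Cardinal.aleph0_le_continuum)
    have hEL : IsLindelof E := isClosed_closure.isLindelof
    choose B hB using fun x : X => (nhds x).exists_antitone_basis
    let U : (ℕ → E × ℕ) → Set X := fun t => ⋃ k, interior (B (t k).1 (t k).2)
    refine ⟨{G | G ∈ Set.range U ∧ E ⊆ G}, ?_, ?_, ?_⟩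
    · have h1 : #(ℕ → E × ℕ) ≤ 𝔠 := by
        apply mk_seq_le
        simp only [Cardinal.mk_prod, Cardinal.lift_uzero, Cardinal.mk_nat, Cardinal.lift_aleph0]
        exact (mul_le_mul' hEc le_rfl).trans (by simp)
      have h2 : {G | G ∈ Set.range U ∧ E ⊆ G} ⊆ Set.range U := fun G hG => hG.1
      exact (Cardinal.mk_le_mk_of_subset h2).trans (Cardinal.mk_range_le.trans h1)
    · rintro G ⟨⟨t, rfl⟩, h⟩
      exact ⟨isOpen_iUnion fun k => isOpen_interior, h⟩
    · intro p hp
      have h1 : ∀ e : E, ∃ n, p ∉ B e n := by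
        intro e
        have hne : (e : X) ≠ p := fun h => hp (h ▸ e.2)
        obtain ⟨n, -, hn⟩ := (hB e).toHasBasis.mem_iff.1 (isOpen_ne.mem_nhds hne)
        exact ⟨n, fun h => hn h rfl⟩
      choose n hn using h1
      obtain ⟨v, hv, hvE⟩ := hEL.elim_countable_subcover (fun e : E => interior (B e (n e)))
        (fun e => isOpen_interior) (fun z hz => Set.mem_iUnion.2 ⟨⟨z, hz⟩,
          mem_interior_iff_mem_nhds.2 ((hB z).toHasBasis.mem_of_mem trivial)⟩)
      have e0 : E := ⟨s 0, subset_closure ⟨0, rfl⟩⟩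
      obtain ⟨r, hr⟩ := (hv.insert e0).exists_eq_range (Set.insert_nonempty _ _)
      refine ⟨U (fun k => (r k, n (r k))), ⟨⟨_, rfl⟩, ?_⟩, ?_⟩
      · intro z hz
        obtain ⟨e, he, hze⟩ := Set.mem_iUnion₂.1 (hvE hz)
        obtain ⟨k, rfl⟩ : e ∈ Set.range r := by rw [← hr]; exact Set.mem_insert_of_mem _ he
        exact Set.mem_iUnion.2 ⟨k, hze⟩
      · intro hpU
        obtain ⟨k, hk⟩ := Set.mem_iUnion.1 hpU
        exact hn (r k) (interior_subset hk)
  · intro D _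
    exact ⟨Set.univ, Set.subset_univ _, isLindelof_univ⟩

/-- The Shapirovskii lemma. -/
theorem exists_discrete {X : Type u} [TopologicalSpace X] (S : Set X) (W : X → Set X)
    (hW : ∀ x ∈ S, IsOpen (W x) ∧ x ∈ W x) :
    ∃ P : Set X, P ⊆ S ∧ DiscreteTopology ↥P ∧ ∀ x ∈ S, x ∈ closure P ∨ ∃ y ∈ P, x ∈ W y := by
  let r : X → X → Prop := WellOrderingRel
  have wf : WellFounded r := IsWellFounded.wf
  let Q : X → Prop := wf.fix (fun x Q => x ∈ S ∧ x ∉ closure {y | ∃ h : r y x, Q y h} ∧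
    ∀ y, ∀ h : r y x, Q y h → x ∉ W y)
  have hQ : ∀ x, Q x ↔ (x ∈ S ∧ x ∉ closure {y | r y x ∧ Q y} ∧ ∀ y, r y x → Q y → x ∉ W y) := by
    intro x
    have := wf.fix_eq (fun x (Q : ∀ y, r y x → Prop) => x ∈ S ∧
      x ∉ closure {y | ∃ h : r y x, Q y h} ∧ ∀ y, ∀ h : r y x, Q y h → x ∉ W y) x
    have h2 : Q x = _ := this
    rw [h2]
    simp only [exists_prop]
    rfl
  refine ⟨{x | Q x}, fun x hx => ((hQ x).1 hx).1, ?_, ?_⟩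
  · rw [discreteTopology_subtype_iff']
    intro x hx
    obtain ⟨h1, h2, h3⟩ := (hQ x).1 hx
    refine ⟨W x ∩ (closure {y | r y x ∧ Q y})ᶜ,
      (hW x h1).1.inter isClosed_closure.isOpen_compl, ?_⟩
    ext y
    constructor
    · rintro ⟨⟨hy1, hy2⟩, hy⟩
      rcases trichotomous_of r y x with h | h | h
      · exact absurd (subset_closure ⟨h, hy⟩ : y ∈ closure {y | r y x ∧ Q y}) hy2
      · exact h
      · exact absurd hy1 (((hQ y).1 hy).2.2 x h hx)
    · rintro rfl
      exact ⟨⟨(hW _ h1).2, h2⟩, hx⟩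
  · intro x hx
    by_contra! hcon
    have : Q x := (hQ x).2 ⟨hx, fun h => hcon.1 (closure_mono (fun y hy => hy.2) h),
      fun y _ hy => hcon.2 y hy⟩
    exact hcon.1 (subset_closure this)

/-- Every first countable, almost discretely Lindelöf, regular Hausdorff (T3) space
has cardinality at most the continuum. -/
theorem almostDiscretelyLindelof_firstCountable_card_le_continuum (X : Type u)
    [TopologicalSpace X] [FirstCountableTopology X] [T3Space X]
    (h : AlmostDiscretelyLindelof X) : #X ≤ 2 ^ ℵ₀ := by
  rw [Cardinal.two_power_aleph0]
  have hD : ∀ D : Set X, DiscreteTopology ↥D → #D ≤ 𝔠 := by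
    intro D hD
    obtain ⟨L, hDL, hL⟩ := h D hD
    have : LindelofSpace L := isLindelof_iff_lindelofSpace.1 hL
    exact (Cardinal.mk_le_mk_of_subset hDL).trans card_le_of_lindelof
  refine card_le_of_pseudo (fun s => ?_) h
  set E := closure (Set.range s) with hE
  have hW : ∀ x, ∃ W : Set X, x ∈ Eᶜ → IsOpen W ∧ x ∈ W ∧ closure W ⊆ Eᶜ := by
    intro x
    by_cases hx : x ∈ Eᶜ
    · obtain ⟨C, hC, hCc, hCE⟩ := exists_mem_nhds_isClosed_subset
        ((isClosed_closure (s := Set.range s)).isOpen_compl.mem_nhds hx)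
      exact ⟨interior C, fun _ => ⟨isOpen_interior, mem_interior_iff_mem_nhds.2 hC,
        (closure_minimal interior_subset hCc).trans hCE⟩⟩
    · exact ⟨∅, fun h => absurd h hx⟩
  choose W hW using hW
  obtain ⟨P, hPE, hPd, hP⟩ := exists_discrete Eᶜ W (fun x hx => ⟨(hW x hx).1, (hW x hx).2.1⟩)
  have hPc := hD P hPd
  refine ⟨(fun y => (closure (W y))ᶜ) '' P ∪ (fun q => ({q} : Set X)ᶜ) '' (closure P ∩ Eᶜ), ?_, ?_, ?_⟩
  · refine (Cardinal.mk_union_le _ _).trans ?_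
    refine (add_le_add (Cardinal.mk_image_le.trans hPc) (Cardinal.mk_image_le.trans
      ((Cardinal.mk_le_mk_of_subset Set.inter_subset_left).trans (mk_closure_le P hPc)))).trans ?_
    simp
  · rintro G (⟨y, hy, rfl⟩ | ⟨q, hq, rfl⟩)
    · exact ⟨isClosed_closure.isOpen_compl,
        Set.subset_compl_comm.1 (hW y (hPE hy)).2.2⟩
    · refine ⟨isOpen_compl_singleton, ?_⟩
      rintro z hz rfl
      exact hq.2 hz
  · intro p hp
    rcases hP p hp with h1 | ⟨y, hy, hpy⟩
    · exact ⟨_, Or.inr ⟨p, ⟨h1, hp⟩, rfl⟩, fun h => h rfl⟩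
    · exact ⟨_, Or.inl ⟨y, hy, rfl⟩, fun h => h (subset_closure hpy)⟩
end
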